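/- arXiv:1310.5656 — 2 statements merged into one kernel-verified Lean document; each statement's English description precedes it below -/
import Mathlib

section
/- Let (X,d,α) and (Y,e,β) be semi-computable metric spaces. If f is (α,β)-computable, then there exists a saturated recursively enumerable metric (α,β)-approximation system for f. -/
/-- A set in a primcodable type is recursively enumerable. -/
def IsRE {α : Type} [Primcodable α] (S : Set α) : Prop :=
  Partrec fun a => Part.assert (a ∈ S) fun _ => Part.some ()

/-- `F` is a recursive operator on partial functions ℕ ⇀ ℕ. -/
def IsRecOp (F : (ℕ →. ℕ) → (ℕ →. ℕ)) : Prop :=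
  ∃ W : Set (List (ℕ × ℕ) × ℕ × ℕ), IsRE W ∧
    ∀ (u : ℕ →. ℕ) (n m : ℕ),
      m ∈ F u n ↔ ∃ l : List (ℕ × ℕ), (∀ p ∈ l, p.2 ∈ u p.1) ∧ (l, n, m) ∈ W

/-- `(Z, dist, γ)` with `dom γ = K` is a semi-computable metric space. -/
def SemiComputable {Z : Type*} [MetricSpace Z] (K : Set ℕ) (γ : ℕ → Z) : Prop :=
  Dense (γ '' K) ∧
  IsRE {q : ℕ × ℕ × ℕ × ℕ | q.1 ∈ K ∧ q.2.1 ∈ K ∧ 0 < q.2.2.1 ∧ 0 < q.2.2.2 ∧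
      dist (γ q.1) (γ q.2.1) < (q.2.2.1 : ℝ) / (q.2.2.2 : ℝ)}

/-- `S ⊆ K×ℕ×L×ℕ` is a metric (α,β)-approximation system for `f` on `E`. -/
def MetricApproxOn {X Y : Type*} [MetricSpace X] [MetricSpace Y]
    (K L : Set ℕ) (α : ℕ → X) (β : ℕ → Y) (r : ℕ → ℚ) (E : Set X) (f : X → Y)
    (S : Set (ℕ × ℕ × ℕ × ℕ)) : Prop :=
  (∀ s ∈ S, s.1 ∈ K ∧ s.2.2.1 ∈ L) ∧
  ∀ x ∈ E,
    (∀ k m l n, (k, m, l, n) ∈ S → dist (α k) x < (r m : ℝ) →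
        dist (β l) (f x) < (r n : ℝ)) ∧
    ∀ n : ℕ, ∃ m : ℕ, ∀ k ∈ K, dist (α k) x < (r m : ℝ) →
        ∃ l, (k, m, l, n) ∈ S

/-- `S` is saturated with respect to α on K and β on L. -/
def SaturatedOn {X Y : Type*} (K L : Set ℕ) (α : ℕ → X) (β : ℕ → Y)
    (S : Set (ℕ × ℕ × ℕ × ℕ)) : Prop :=
  ∀ k m l n, (k, m, l, n) ∈ S → ∀ k' ∈ K, ∀ l' ∈ L,
    α k' = α k → β l' = β l → (k', m, l', n) ∈ S

theorem enc_rat (q : ℚ) : @Encodable.encode ℚ Rat.instEncodable q =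
   Nat.pair (@Encodable.encode ℤ _ q.num) q.den := by
  cases q; rfl
theorem enc_int1 (n : ℕ) : @Encodable.encode ℤ Int.encodable (Int.ofNat n) = 2*n := by
  rfl
theorem enc_int2 (n : ℕ) : @Encodable.encode ℤ Int.encodable (Int.negSucc n) = 2*n+1 := by
  rfl

theorem coprime_pr : PrimrecRel (fun a b : ℕ => Nat.Coprime a b) := by
  have h1 : PrimrecRel (fun (d : ℕ) (p : ℕ × ℕ) => p.1 % d = 0 → p.2 % d = 0 → d = 1) := by
    have : PrimrecPred (fun x : ℕ × (ℕ × ℕ) => (¬ x.2.1 % x.1 = 0) ∨ (¬ x.2.2 % x.1 = 0) ∨ x.1 = 1) := by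
      refine .or (.not ?_) (.or (.not ?_) ?_)
      · exact Primrec.eq.comp (Primrec.nat_mod.comp (Primrec.fst.comp Primrec.snd) Primrec.fst) (Primrec.const 0)
      · exact Primrec.eq.comp (Primrec.nat_mod.comp (Primrec.snd.comp Primrec.snd) Primrec.fst) (Primrec.const 0)
      · exact Primrec.eq.comp Primrec.fst (Primrec.const 1)
    exact PrimrecPred.of_eq this (fun x => by tauto)
  have h2 := h1.forall_mem_list
  have h3 : PrimrecPred (fun x : ℕ × ℕ => ∀ d ∈ List.range (x.1 + x.2 + 1), x.1 % d = 0 → x.2 % d = 0 → d = 1) :=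
    PrimrecRel.comp h2 (Primrec.list_range.comp (Primrec.succ.comp (Primrec.nat_add.comp Primrec.fst Primrec.snd))) Primrec.id
  refine PrimrecPred.of_eq h3 ?_
  rintro ⟨a, b⟩
  simp only [List.mem_range]
  constructor
  · intro h
    apply h (Nat.gcd a b)
    · rcases Nat.eq_zero_or_pos a with rfl | ha
      · simp
      · have := Nat.gcd_le_left b ha
        omega
    · exact Nat.mod_eq_zero_of_dvd (Nat.gcd_dvd_left a b)
    · exact Nat.mod_eq_zero_of_dvd (Nat.gcd_dvd_right a b)
  · intro h d _ h1 h2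
    exact Nat.eq_one_of_dvd_coprimes h (Nat.dvd_of_mod_eq_zero h1) (Nat.dvd_of_mod_eq_zero h2)

def rset : Set ℕ := Set.range (@Encodable.encode ℚ Rat.instEncodable)

theorem mem_rset (c : ℕ) : c ∈ rset ↔ 0 < c.unpair.2 ∧
    Nat.Coprime (c.unpair.1 / 2 + c.unpair.1 % 2) c.unpair.2 := by
  constructor
  · rintro ⟨q, rfl⟩
    rw [enc_rat]
    simp only [Nat.unpair_pair]
    refine ⟨q.den_pos, ?_⟩
    have h := q.reduced
    rcases hq : q.num with n | n
    · rw [enc_int1]; rw [hq] at h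
      have e : 2 * n / 2 + 2 * n % 2 = n := by omega
      rw [e]; exact h
    · rw [enc_int2]; rw [hq] at h
      have e : (2 * n + 1) / 2 + (2 * n + 1) % 2 = n + 1 := by omega
      rw [e]; exact h
  · rintro ⟨h1, h2⟩
    obtain ⟨n, hn | hn⟩ := Nat.even_or_odd' c.unpair.1
    · rw [hn] at h2
      have e : 2 * n / 2 + 2 * n % 2 = n := by omega
      rw [e] at h2
      refine ⟨⟨Int.ofNat n, c.unpair.2, h1.ne', h2⟩, ?_⟩
      rw [enc_rat]
      change Nat.pair (2 * n) c.unpair.2 = c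
      rw [← hn, Nat.pair_unpair]
    · rw [hn] at h2
      have e : (2 * n + 1) / 2 + (2 * n + 1) % 2 = n + 1 := by omega
      rw [e] at h2
      refine ⟨⟨Int.negSucc n, c.unpair.2, h1.ne', h2⟩, ?_⟩
      rw [enc_rat]
      change Nat.pair (2 * n + 1) c.unpair.2 = c
      rw [← hn, Nat.pair_unpair]

theorem rset_pr : PrimrecPred (fun c => c ∈ rset) := by
  have a1 : Primrec (fun c : ℕ => c.unpair.1) := Primrec.fst.comp Primrec.unpair
  have a2 : Primrec (fun c : ℕ => c.unpair.2) := Primrec.snd.comp Primrec.unpair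
  refine PrimrecPred.of_eq (PrimrecPred.and ?_ ?_) (fun c => (mem_rset c).symm)
  · exact Primrec.nat_lt.comp (Primrec.const 0) a2
  · exact coprime_pr.comp (Primrec.nat_add.comp (Primrec.nat_div.comp a1 (Primrec.const 2))
      (Primrec.nat_mod.comp a1 (Primrec.const 2))) a2

instance : DecidablePred (· ∈ rset) := @Encodable.decidableRangeEncode ℚ _
instance : Infinite rset := Infinite.of_injective _ (Equiv.ofInjective _ (Encodable.encode_injective (α := ℚ))).injective

theorem ofNat_rat (n : ℕ) : @Encodable.encode ℚ Rat.instEncodable (Denumerable.ofNat ℚ n)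
   = (Nat.Subtype.ofNat rset n : ℕ) := by
  have h := (Encodable.equivRangeEncode ℚ).apply_symm_apply (Nat.Subtype.ofNat rset n)
  exact congrArg Subtype.val h

theorem ofNat_comp : Computable (fun n => (Nat.Subtype.ofNat rset n : ℕ)) := by
  have hex : ∀ x : ℕ, ∃ m, x + m + 1 ∈ rset := by
    intro x
    obtain ⟨y, hy, h⟩ := (Set.infinite_coe_iff.mp (inferInstance : Infinite rset)).exists_gt x
    exact ⟨y - x - 1, by rwa [show x + (y - x - 1) + 1 = y by omega]⟩
  have hp : ComputablePred (fun p : ℕ × ℕ => p.1 + p.2 + 1 ∈ rset) :=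
    PrimrecPred.computablePred (rset_pr.comp (Primrec.succ.comp (Primrec.nat_add.comp Primrec.fst Primrec.snd)))
  have hf := Computable.find (P := fun x m => x + m + 1 ∈ rset) hp hex
  have hg : Computable₂ (fun (_ : ℕ) (p : ℕ × ℕ) => p.2 + Nat.find (hex p.2) + 1) := by
    have e : Computable (fun p : ℕ × (ℕ × ℕ) => p.2.2) := Computable.snd.comp Computable.snd
    exact Computable.succ.comp ((Primrec.nat_add.to_comp).comp e (hf.comp e))
  have := Computable.nat_rec (f := fun n : ℕ => n) (g := fun _ => ((Nat.Subtype.ofNat rset 0 : rset) : ℕ)) Computable.id (Computable.const _) hg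
  refine this.of_eq ?_
  intro n
  induction n with
  | zero => rfl
  | succ n ih => 
    simp only at ih ⊢
    rw [ih]
    rfl

theorem rat_enc_comp : Computable (fun q : ℚ => @Encodable.encode ℚ Rat.instEncodable q) := by
  have h := ofNat_comp.comp (Computable.encode (α := ℚ))
  refine h.of_eq (fun q => ?_)
  rw [← ofNat_rat, Denumerable.ofNat_encode]

theorem num_comp (r : ℕ → ℚ) (hr : Computable r) (hpos : ∀ n, 0 < r n) :
    ∃ N D : ℕ → ℕ, Computable N ∧ Computable D ∧ (∀ n, 0 < N n) ∧ (∀ n, 0 < D n) ∧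
      ∀ n, (r n : ℝ) = (N n : ℝ) / (D n : ℝ) := by
  have h := rat_enc_comp.comp hr
  have a1 : Primrec (fun c : ℕ => c.unpair.1 / 2) :=
    Primrec.nat_div.comp (Primrec.fst.comp Primrec.unpair) (Primrec.const 2)
  have a2 : Primrec (fun c : ℕ => c.unpair.2) := Primrec.snd.comp Primrec.unpair
  have key : ∀ n, 0 < (r n).num := fun n => Rat.num_pos.mpr (hpos n)
  refine ⟨fun n => (r n).num.toNat, fun n => (r n).den, (a1.to_comp.comp h).of_eq ?_,
    (a2.to_comp.comp h).of_eq ?_, ?_, fun n => (r n).den_pos, ?_⟩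
  · intro n
    rw [enc_rat, Nat.unpair_pair]
    have := key n
    rcases hq : (r n).num with m | m
    · rw [enc_int1]; simp
    · rw [hq] at this; exact absurd this (by simp)
  · intro n
    rw [enc_rat, Nat.unpair_pair]
  · intro n
    have := key n
    show 0 < (r n).num.toNat
    omega
  · intro n
    have e : (((r n).num.toNat : ℤ)) = (r n).num := Int.toNat_of_nonneg (key n).le
    have e2 : (((r n).num.toNat : ℝ)) = ((r n).num : ℝ) := by exact_mod_cast e
    show (r n : ℝ) = ((r n).num.toNat : ℝ) / ((r n).den : ℝ)
    rw [e2, Rat.cast_def]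

open Nat.Partrec in
theorem re_stage {α : Type} [Primcodable α] {p : α → Prop} (hp : REPred p) :
    ∃ b : α → ℕ → Prop, PrimrecRel b ∧ (∀ a i j, i ≤ j → b a i → b a j) ∧ ∀ a, p a ↔ ∃ k, b a k := by
  obtain ⟨c, hc⟩ := Code.exists_code.1 hp
  refine ⟨fun a k => (Code.evaln k c (Encodable.encode a)).isSome = true, ?_, ?_, ?_⟩
  · have : Primrec (fun x : α × ℕ => (Code.evaln x.2 c (Encodable.encode x.1)).isSome) :=
      Primrec.option_isSome.comp (Code.primrec_evaln.comp
        ((Primrec.snd.pair (Primrec.const c)).pair (Primrec.encode.comp Primrec.fst)))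
    exact Primrec.eq.comp this (Primrec.const true)
  · intro a i j hij h
    rw [Option.isSome_iff_exists] at h ⊢
    obtain ⟨v, hv⟩ := h
    exact ⟨v, Code.evaln_mono hij hv⟩
  · intro a
    have h1 : p a ↔ (c.eval (Encodable.encode a)).Dom := by
      rw [hc]; simp only [Encodable.encodek]
      simp [Part.assert]
    rw [h1, Part.dom_iff_mem]
    simp only [Code.evaln_complete, Option.isSome_iff_exists]
    exact exists_comm

theorem re_of_stage {α : Type} [Primcodable α] {b : α → ℕ → Prop} (hb : PrimrecRel b) :
    REPred (fun a => ∃ k, b a k) := by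
  classical
  have h : Partrec (fun x ↦ Nat.rfind fun n => Part.some (decide (b x n))) :=
    Partrec.rfind (PrimrecPred.computablePred hb).decide.partrec
  refine h.dom_re.of_eq (fun a => ?_)
  refine Nat.rfind_dom.trans ?_
  simp

theorem re_comp {α β : Type} [Primcodable α] [Primcodable β] {p : β → Prop} (hp : REPred p)
    {g : α → β} (hg : Computable g) : REPred (fun a => p (g a)) :=
  Partrec.comp hp hg

theorem re_and {α : Type} [Primcodable α] {p q : α → Prop} (hp : REPred p) (hq : REPred q) :
    REPred (fun a => p a ∧ q a) := by
  obtain ⟨b, hb, mb, eb⟩ := re_stage hp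
  obtain ⟨c, hc, mc, ec⟩ := re_stage hq
  refine (re_of_stage (b := fun a k => b a k ∧ c a k) (PrimrecPred.and hb hc)).of_eq (fun a => ?_)
  rw [eb, ec]
  constructor
  · rintro ⟨k, h1, h2⟩; exact ⟨⟨k, h1⟩, ⟨k, h2⟩⟩
  · rintro ⟨⟨i, h1⟩, ⟨j, h2⟩⟩
    exact ⟨max i j, mb _ _ _ (le_max_left _ _) h1, mc _ _ _ (le_max_right _ _) h2⟩

theorem re_ex {α β : Type} [Primcodable α] [Primcodable β] [Inhabited β] {p : α × β → Prop} (hp : REPred p) :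
    REPred (fun a => ∃ b, p (a, b)) := by
  obtain ⟨b, hb, mb, eb⟩ := re_stage hp
  have : PrimrecRel (fun (a : α) (k : ℕ) => b (a, ((Encodable.decode k.unpair.1 : Option β).getD default)) k.unpair.2) :=
    PrimrecRel.comp hb (Primrec.fst.pair (Primrec.option_getD.comp (Primrec.decode.comp (Primrec.fst.comp (Primrec.unpair.comp Primrec.snd))) (Primrec.const default)))
      (Primrec.snd.comp (Primrec.unpair.comp Primrec.snd))
  refine (re_of_stage this).of_eq (fun a => ?_)
  constructor
  · rintro ⟨k, h⟩; exact ⟨_, (eb _).2 ⟨_, h⟩⟩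
  · rintro ⟨x, h⟩
    obtain ⟨k, hk⟩ := (eb _).1 h
    exact ⟨Nat.pair (Encodable.encode x) k, by simpa using hk⟩

theorem re_all {α β : Type} [Primcodable α] [Primcodable β] {p : α × β → Prop} (hp : REPred p)
    {g : α → List β} (hg : Computable g) :
    REPred (fun a => ∀ x ∈ g a, p (a, x)) := by
  obtain ⟨b, hb, mb, eb⟩ := re_stage hp
  have h1 : PrimrecRel (fun (x : β) (y : α × ℕ) => b (y.1, x) y.2) :=
    PrimrecRel.comp hb ((Primrec.fst.comp Primrec.snd).pair Primrec.fst) (Primrec.snd.comp Primrec.snd)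
  have h2 := h1.forall_mem_list
  have h3 : PrimrecRel (fun (z : α × List β) (k : ℕ) => ∀ x ∈ z.2, b (z.1, x) k) :=
    PrimrecRel.comp h2 (Primrec.snd.comp Primrec.fst) ((Primrec.fst.comp Primrec.fst).pair Primrec.snd)
  refine (re_comp (re_of_stage h3) (Computable.id.pair hg)).of_eq (fun a => ?_)
  simp only [eb, id]
  constructor
  · rintro ⟨k, h⟩ x hx; exact ⟨k, h x hx⟩
  · generalize g a = l
    induction l with
    | nil => intro _; exact ⟨0, by simp⟩
    | cons y l ih =>
      intro h
      obtain ⟨i, hi⟩ := ih (fun x hx => h x (List.mem_cons_of_mem _ hx))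
      obtain ⟨j, hj⟩ := h y List.mem_cons_self
      refine ⟨max i j, fun x hx => ?_⟩
      rcases List.mem_cons.1 hx with rfl | hx
      · exact mb _ _ _ (le_max_right _ _) hj
      · exact mb _ _ _ (le_max_left _ _) (hi x hx)

theorem frac_sub {a b c d : ℕ} (hb : 0 < b) (hd : 0 < d) {x : ℝ} (hx : 0 ≤ x) :
    (0 < a * d - c * b ∧ 0 < b * d ∧ x < ((a * d - c * b : ℕ) : ℝ) / ((b * d : ℕ) : ℝ)) ↔
      x + (c : ℝ) / d < (a : ℝ) / b := by
  have hb' : (0 : ℝ) < b := by exact_mod_cast hb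
  have hd' : (0 : ℝ) < d := by exact_mod_cast hd
  have e : (a : ℝ) / b - c / d = ((a : ℝ) * d - c * b) / (b * d) := by
    field_simp
  constructor
  · rintro ⟨h1, h2, h3⟩
    rw [Nat.cast_sub (by omega)] at h3
    push_cast at h3
    rw [← e] at h3
    linarith
  · intro h
    have h3 : x < (a : ℝ) / b - c / d := by linarith
    have h4 : 0 < (a : ℝ) / b - c / d := by linarith
    rw [e] at h3 h4
    have h5 : (0 : ℝ) < (a : ℝ) * d - c * b := by
      by_contra hn
      exact absurd h4 (not_lt.2 (div_nonpos_of_nonpos_of_nonneg (not_lt.1 hn) (by positivity)))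
    have h6 : c * b < a * d := by
      have : (c : ℝ) * b < a * d := by linarith
      exact_mod_cast this
    refine ⟨by omega, by positivity, ?_⟩
    rw [Nat.cast_sub h6.le]
    push_cast
    exact h3

theorem re_func : REPred (fun l : List (ℕ × ℕ) => ∀ p ∈ l, ∀ q ∈ l, p.1 = q.1 → p.2 = q.2) := by
  have h : PrimrecPred (fun x : (List (ℕ × ℕ) × (ℕ × ℕ)) × (ℕ × ℕ) =>
      (¬ x.1.2.1 = x.2.1) ∨ x.1.2.2 = x.2.2) := by
    refine .or (.not ?_) ?_
    · exact Primrec.eq.comp (Primrec.fst.comp (Primrec.snd.comp Primrec.fst)) (Primrec.fst.comp Primrec.snd)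
    · exact Primrec.eq.comp (Primrec.snd.comp (Primrec.snd.comp Primrec.fst)) (Primrec.snd.comp Primrec.snd)
  have h1 := re_all (PrimrecPred.computablePred h).to_re
    (g := fun x : List (ℕ × ℕ) × (ℕ × ℕ) => x.1) Computable.fst
  have h2 := re_all h1 (g := fun x : List (ℕ × ℕ) => x) Computable.id
  refine h2.of_eq (fun l => ?_)
  simp only [imp_iff_not_or]

theorem stmt15 {X Y : Type*} [MetricSpace X] [MetricSpace Y]
    (K L : Set ℕ) (α : ℕ → X) (β : ℕ → Y)
    (hX : SemiComputable K α) (hY : SemiComputable L β)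
    (r : ℕ → ℚ) (hrpos : ∀ n, 0 < r n)
    (hracc : ∀ ε : ℝ, 0 < ε → ∃ n, (r n : ℝ) < ε) (hrcomp : Computable r)
    (E : Set X) (f : X → Y)
    (hcomp : ∃ F : (ℕ →. ℕ) → (ℕ →. ℕ), IsRecOp F ∧
        ∀ x ∈ E, ∀ u : ℕ → ℕ, (∀ t, u t ∈ K ∧ dist (α (u t)) x < (r t : ℝ)) →
          ∀ n : ℕ, ∃ l : ℕ, F (fun t => Part.some (u t)) n = Part.some l ∧
            l ∈ L ∧ dist (β l) (f x) < (r n : ℝ)) :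
    ∃ S : Set (ℕ × ℕ × ℕ × ℕ), IsRE S ∧ SaturatedOn K L α β S ∧
      MetricApproxOn K L α β r E f S := by
  classical
  obtain ⟨N, D, hN, hD, hNp, hDp, hr⟩ := num_comp r hrcomp hrpos
  obtain ⟨hXd, hXre⟩ := hX
  obtain ⟨hYd, hYre⟩ := hY
  obtain ⟨F, ⟨W, hW, hFW⟩, hF⟩ := hcomp
  set DX : Set (ℕ × ℕ × ℕ × ℕ) := {q : ℕ × ℕ × ℕ × ℕ | q.1 ∈ K ∧ q.2.1 ∈ K ∧ 0 < q.2.2.1 ∧ 0 < q.2.2.2 ∧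
      dist (α q.1) (α q.2.1) < (q.2.2.1 : ℝ) / (q.2.2.2 : ℝ)} with hDX
  set DY : Set (ℕ × ℕ × ℕ × ℕ) := {q : ℕ × ℕ × ℕ × ℕ | q.1 ∈ L ∧ q.2.1 ∈ L ∧ 0 < q.2.2.1 ∧ 0 < q.2.2.2 ∧
      dist (β q.1) (β q.2.1) < (q.2.2.1 : ℝ) / (q.2.2.2 : ℝ)} with hDY
  have eX : ∀ j k t m, (j, k, N t * D m - N m * D t, D t * D m) ∈ DX ↔
      j ∈ K ∧ k ∈ K ∧ dist (α j) (α k) + r m < r t := by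
    intro j k t m
    rw [hr, hr, ← frac_sub (hDp t) (hDp m) dist_nonneg]
    rfl
  have eY : ∀ j k t m, (j, k, N t * D m - N m * D t, D t * D m) ∈ DY ↔
      j ∈ L ∧ k ∈ L ∧ dist (β j) (β k) + r m < r t := by
    intro j k t m
    rw [hr, hr, ← frac_sub (hDp t) (hDp m) dist_nonneg]
    rfl
  have eK : ∀ k, (k, k, 1, 1) ∈ DX ↔ k ∈ K := by
    intro k
    simp [hDX]
  have hWre : REPred (fun w => w ∈ W) := hW
  have hXre' : REPred (fun w => w ∈ DX) := hXre
  have hYre' : REPred (fun w => w ∈ DY) := hYre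
  -- the tail of four-tuples
  have hq : ∀ {A : Type} [Primcodable A] {a b : A → ℕ}, Computable a → Computable b →
      Computable (fun x => (N (a x) * D (b x) - N (b x) * D (a x), D (a x) * D (b x))) := by
    intro A _ a b ha hb
    exact (Primrec.nat_sub.to_comp.comp (Primrec.nat_mul.to_comp.comp (hN.comp ha) (hD.comp hb))
      (Primrec.nat_mul.to_comp.comp (hN.comp hb) (hD.comp ha))).pair
      (Primrec.nat_mul.to_comp.comp (hD.comp ha) (hD.comp hb))
  let P : (ℕ × ℕ × ℕ × ℕ) × (List (ℕ × ℕ) × ℕ × ℕ) → Prop := fun z =>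
    (z.2 ∈ W ∧ (∀ p ∈ z.2.1, ∀ q ∈ z.2.1, p.1 = q.1 → p.2 = q.2)) ∧
    (∀ p ∈ z.2.1, (p.2, z.1.1, N p.1 * D z.1.2.1 - N z.1.2.1 * D p.1, D p.1 * D z.1.2.1) ∈ DX) ∧
    (z.2.2.2, z.1.2.2.1, N z.1.2.2.2 * D z.2.2.1 - N z.2.2.1 * D z.1.2.2.2,
      D z.1.2.2.2 * D z.2.2.1) ∈ DY
  have hP : REPred P := by
    have c1 : Computable (fun z : (ℕ × ℕ × ℕ × ℕ) × (List (ℕ × ℕ) × ℕ × ℕ) => z.2.1) :=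
      Computable.fst.comp Computable.snd
    refine re_and (re_and (re_comp hWre Computable.snd) (re_comp re_func c1)) (re_and ?_ ?_)
    · refine re_all (p := fun y : ((ℕ × ℕ × ℕ × ℕ) × (List (ℕ × ℕ) × ℕ × ℕ)) × (ℕ × ℕ) =>
        (y.2.2, y.1.1.1, N y.2.1 * D y.1.1.2.1 - N y.1.1.2.1 * D y.2.1,
          D y.2.1 * D y.1.1.2.1) ∈ DX) ?_ c1
      refine re_comp hXre' ((Computable.snd.comp Computable.snd).pair
        ((Computable.fst.comp (Computable.fst.comp Computable.fst)).pair
        (hq (Computable.fst.comp Computable.snd)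
          (Computable.fst.comp (Computable.snd.comp (Computable.fst.comp Computable.fst))))))
    · refine re_comp hYre' ((Computable.snd.comp (Computable.snd.comp Computable.snd)).pair
        ((Computable.fst.comp (Computable.snd.comp (Computable.snd.comp Computable.fst))).pair
        (hq (Computable.snd.comp (Computable.snd.comp (Computable.snd.comp Computable.fst)))
          (Computable.fst.comp (Computable.snd.comp Computable.snd)))))
  have near : ∀ x : X, ∀ ε : ℝ, 0 < ε → ∃ k ∈ K, dist (α k) x < ε := by
    intro x ε hε
    obtain ⟨_, ⟨k, hk, rfl⟩, h⟩ := hXd.exists_dist_lt x hε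
    exact ⟨k, hk, by rwa [dist_comm]⟩
  have rpos : ∀ t, (0 : ℝ) < r t := fun t => by exact_mod_cast hrpos t
  refine ⟨{s | (s.1, s.1, 1, 1) ∈ DX ∧ ∃ w, P (s, w)}, ?_, ?_, ?_, ?_⟩
  · have : REPred (fun s : ℕ × ℕ × ℕ × ℕ => (s.1, s.1, 1, 1) ∈ DX ∧ ∃ w, P (s, w)) := by
      refine re_and (re_comp hXre' ?_) (re_ex hP)
      exact Computable.fst.pair (Computable.fst.pair (Computable.const (1, 1)))
    exact this
  · rintro k m l n ⟨hk, ⟨σ, n', l'⟩, ⟨hw, hfun⟩, hx, hy⟩ k' hk' l' hl' ek el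
    refine ⟨(eK _).2 hk', ⟨σ, n', _⟩, ⟨hw, hfun⟩, ?_, ?_⟩
    · intro p hp
      have := (eX _ _ _ _).1 (hx p hp)
      refine (eX _ _ _ _).2 ⟨this.1, hk', ?_⟩
      dsimp only
      rw [ek]; exact this.2.2
    · have := (eY _ _ _ _).1 hy
      refine (eY _ _ _ _).2 ⟨this.1, hl', ?_⟩
      rw [el]; exact this.2.2
  · rintro ⟨k, m, l, n⟩ ⟨hk, ⟨σ, n', l'⟩, ⟨hw, hfun⟩, hx, hy⟩
    exact ⟨(eK _).1 hk, ((eY _ _ _ _).1 hy).2.1⟩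
  · intro x hxE
    constructor
    · rintro k m l n ⟨hk, ⟨σ, n', l'⟩, ⟨hw, hfun⟩, hx, hy⟩ hd
      have hu : ∀ t, ∃ j, (j ∈ K ∧ dist (α j) x < r t) ∧ ∀ p ∈ σ, p.1 = t → p.2 = j := by
        intro t
        by_cases h : ∃ p ∈ σ, p.1 = t
        · obtain ⟨p, hp, rfl⟩ := h
          obtain ⟨h1, h2, h3⟩ := (eX _ _ _ _).1 (hx p hp)
          refine ⟨p.2, ⟨h1, ?_⟩, fun q hq' e => hfun q hq' p hp e⟩
          have := dist_triangle (α p.2) (α k) x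
          dsimp only at h3
          linarith
        · obtain ⟨j, hj, hj'⟩ := near x (r t) (rpos t)
          exact ⟨j, ⟨hj, hj'⟩, fun p hp e => absurd ⟨p, hp, e⟩ h⟩
      choose u hu1 hu2 using hu
      obtain ⟨l₀, hl₀, hl₁, hl₂⟩ := hF x hxE u hu1 n'
      have hm : l' ∈ F (fun t => Part.some (u t)) n' :=
        (hFW _ _ _).2 ⟨σ, fun p hp => by
          rw [Part.mem_some_iff]; exact hu2 _ p hp rfl, hw⟩
      rw [hl₀, Part.mem_some_iff] at hm
      subst hm
      obtain ⟨_, _, h3⟩ := (eY _ _ _ _).1 hy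
      have := dist_triangle_left (β l) (f x) (β l')
      dsimp only at h3
      linarith
    · intro n
      obtain ⟨n', hn'⟩ := hracc (r n) (rpos n)
      have hu : ∀ t, ∃ j, j ∈ K ∧ dist (α j) x < (r t : ℝ) / 2 := fun t => by
        obtain ⟨j, h1, h2⟩ := near x (r t / 2) (half_pos (rpos t))
        exact ⟨j, h1, h2⟩
      choose u hu1 hu2 using hu
      obtain ⟨l', hl₀, hl₁, hl₂⟩ := hF x hxE u
        (fun t => ⟨hu1 t, (hu2 t).trans (half_lt_self (rpos t))⟩) n'
      have hm : l' ∈ F (fun t => Part.some (u t)) n' := by rw [hl₀]; exact Part.mem_some _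
      obtain ⟨σ, hσ, hw⟩ := (hFW _ _ _).1 hm
      have hσ' : ∀ p ∈ σ, p.2 = u p.1 := fun p hp => Part.mem_some_iff.1 (hσ p hp)
      have hε : ∃ ε : ℝ, 0 < ε ∧ ∀ p ∈ σ, ε ≤ (r p.1 : ℝ) / 4 := by
        clear hσ hw hσ'
        induction σ with
        | nil => exact ⟨1, one_pos, by simp⟩
        | cons p σ ih =>
          obtain ⟨ε, h1, h2⟩ := ih
          refine ⟨min ε ((r p.1 : ℝ) / 4), lt_min h1 (by have := rpos p.1; positivity), ?_⟩
          intro q hq'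
          rcases List.mem_cons.1 hq' with rfl | hq'
          · exact min_le_right _ _
          · exact (min_le_left _ _).trans (h2 q hq')
      obtain ⟨ε, hε0, hε⟩ := hε
      obtain ⟨m, hm'⟩ := hracc ε hε0
      refine ⟨m, fun k hk hd => ⟨l', (eK _).2 hk, ⟨σ, n', l'⟩, ⟨hw, ?_⟩, ?_, ?_⟩⟩
      · intro p hp q hq' e
        rw [hσ' p hp, hσ' q hq', e]
      · intro p hp
        refine (eX _ _ _ _).2 ⟨?_, hk, ?_⟩
        · rw [hσ' p hp]; exact hu1 _
        · rw [hσ' p hp]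
          have h1 := hu2 p.1
          have h2 := hε p hp
          have h3 := dist_triangle_right (α (u p.1)) (α k) x
          dsimp only
          linarith
      · refine (eY _ _ _ _).2 ⟨hl₁, hl₁, ?_⟩
        rw [dist_self, zero_add]
        exact hn'
end

section
/- Let (X,d,α) and (Y,e,β) be semi-computable metric spaces. Then there exists a recursive operator Γ which transforms every β-name of every element y of Y into a V-name of y, i.e., into a total enumeration of the set [y]_V = {⟨l,n⟩ | l ∈ L, n ∈ ℕ, e(β(l), y) < r_n}. -/
namespace Stmt17Aux
open Encodable

noncomputable def oldCode (q : ℚ) : ℕ := @encode ℚ Rat.instEncodable q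

noncomputable def newCode (q : ℚ) : ℕ := @encode ℚ Rat.instDenumerable.toEncodable q

theorem int_encode (z : ℤ) : (encode z + 1) / 2 = z.natAbs := by
  show (Equiv.intEquivNat z + 1) / 2 = z.natAbs
  rcases z with n | n
  · show (2 * n + 1) / 2 = n
    omega
  · show (2 * n + 1 + 1) / 2 = n + 1
    omega

theorem int_encode_nonneg (n : ℕ) : encode (n : ℤ) = 2 * n := rfl

theorem oldCode_eq (q : ℚ) : oldCode q = Nat.pair (encode q.num) q.den := rfl

def SP (m : ℕ) : Prop :=
  0 < m.unpair.2 ∧ Nat.Coprime ((m.unpair.1 + 1) / 2) m.unpair.2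

theorem range_iff (m : ℕ) : m ∈ Set.range oldCode ↔ SP m := by
  constructor
  · rintro ⟨q, rfl⟩
    rw [oldCode_eq]
    simp only [SP, Nat.unpair_pair, int_encode]
    exact ⟨q.den_pos, q.reduced⟩
  · rintro ⟨h1, h2⟩
    obtain ⟨z, hz⟩ : ∃ z : ℤ, encode z = m.unpair.1 :=
      ⟨Denumerable.ofNat ℤ m.unpair.1, Denumerable.encode_ofNat _⟩
    rw [← hz, int_encode] at h2
    refine ⟨⟨z, m.unpair.2, h1.ne', h2⟩, ?_⟩
    rw [oldCode_eq]
    simp [hz]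

theorem cop_iff (a b : ℕ) (hb : 0 < b) :
    Nat.Coprime a b ↔ ∀ x < b + 1, ¬ (1 < x ∧ a % x = 0 ∧ b % x = 0) := by
  constructor
  · rintro h x - ⟨h1, h2, h3⟩
    have := Nat.eq_one_of_dvd_coprimes h (Nat.dvd_of_mod_eq_zero h2) (Nat.dvd_of_mod_eq_zero h3)
    omega
  · intro h
    by_contra hc
    have hg : 0 < Nat.gcd a b := Nat.gcd_pos_of_pos_right _ hb
    have hg' : Nat.gcd a b ≠ 1 := hc
    refine h (Nat.gcd a b) (Nat.lt_succ_of_le (Nat.gcd_le_right _ hb)) ⟨by omega, ?_, ?_⟩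
    · exact Nat.mod_eq_zero_of_dvd (Nat.gcd_dvd_left a b)
    · exact Nat.mod_eq_zero_of_dvd (Nat.gcd_dvd_right a b)

theorem SP_primrec : PrimrecPred SP := by
  have h1 : Primrec fun m : ℕ => m.unpair.1 := Primrec.fst.comp Primrec.unpair
  have h2 : Primrec fun m : ℕ => m.unpair.2 := Primrec.snd.comp Primrec.unpair
  have h3 : Primrec fun m : ℕ => (m.unpair.1 + 1) / 2 :=
    Primrec.nat_div.comp (Primrec.succ.comp h1) (Primrec.const 2)
  have hR : PrimrecRel fun (x : ℕ) (m : ℕ) =>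
      ¬ (1 < x ∧ ((m.unpair.1 + 1) / 2) % x = 0 ∧ m.unpair.2 % x = 0) := by
    refine PrimrecPred.not ?_
    refine (Primrec.nat_lt.comp (Primrec.const 1) Primrec.fst).and
      (PrimrecPred.and ?_ ?_)
    · exact Primrec.eq.comp (Primrec.nat_mod.comp (h3.comp Primrec.snd) Primrec.fst)
        (Primrec.const 0)
    · exact Primrec.eq.comp (Primrec.nat_mod.comp (h2.comp Primrec.snd) Primrec.fst)
        (Primrec.const 0)
  have := (Primrec.nat_lt.comp (Primrec.const 0) h2).and
    (hR.forall_lt.comp (Primrec.succ.comp h2) Primrec.id)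
  refine this.of_eq fun m => ?_
  unfold SP
  refine and_congr_right fun h => ?_
  rw [cop_iff _ _ h]
  rfl

theorem infS : Infinite (Set.range oldCode) :=
  Infinite.of_injective _ (Equiv.ofInjective _
    (@encode_injective ℚ Rat.instEncodable)).injective

theorem exists_nxt (x : ℕ) : ∃ m, SP (x + m + 1) := by
  have : (Set.range oldCode).Infinite := Set.infinite_coe_iff.1 infS
  obtain ⟨y, hy, hxy⟩ := this.exists_gt x
  refine ⟨y - x - 1, ?_⟩
  rw [show x + (y - x - 1) + 1 = y by omega]
  exact (range_iff y).1 hy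

theorem exists_O : ∃ O : ℕ → ℕ, Computable O ∧ ∀ q : ℚ, oldCode q = O (newCode q) := by
  classical
  let := @decidableRangeEncode ℚ Rat.instEncodable
  let hI : Infinite (Set.range (@encode ℚ Rat.instEncodable)) := infS
  refine ⟨fun n => (Nat.Subtype.ofNat (Set.range (@encode ℚ Rat.instEncodable)) n).1, ?_, ?_⟩
  · have hg : Computable fun x : ℕ => Nat.find (exists_nxt x) := by
      refine Computable.find (P := fun x m => SP (x + m + 1)) ?_ exists_nxt
      exact (PrimrecPred.comp SP_primrec (Primrec.succ.comp Primrec.nat_add)).computablePred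
    have hs : Computable₂ fun (_ : ℕ) (p : ℕ × ℕ) => p.2 + Nat.find (exists_nxt p.2) + 1 := by
      have : Computable fun x : ℕ => x + Nat.find (exists_nxt x) + 1 :=
        Computable.succ.comp (Primrec.nat_add.to_comp.comp Computable.id hg)
      exact this.comp (Computable.snd.comp Computable.snd)
    refine (Computable.nat_rec Computable.id
      (Computable.const (Nat.Subtype.ofNat (Set.range (@encode ℚ Rat.instEncodable)) 0).1)
      hs).of_eq fun n => ?_
    simp only [id]
    induction n with
    | zero => rfl
    | succ n ih =>
      simp only [ih]
      show _ = (Nat.Subtype.succ _).1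
      simp only [Nat.Subtype.succ]
      congr 2
      apply Nat.find_congr'
      intro m
      exact (range_iff _).symm
  · intro q
    have := @Denumerable.ofNat_encode _ (Nat.Subtype.denumerable (Set.range (@encode ℚ Rat.instEncodable)))
      ⟨@encode ℚ Rat.instEncodable q, Set.mem_range_self _⟩
    exact (congrArg Subtype.val this).symm

theorem num_den_computable (r : ℕ → ℚ) (hr : ∀ n, 0 < r n) (hc : Computable r) :
    ∃ A B : ℕ → ℕ, Computable A ∧ Computable B ∧ ∀ n, 0 < B n ∧ r n = (A n : ℚ) / (B n : ℚ) := by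
  obtain ⟨O, hO, h⟩ := exists_O
  have hx : Computable fun n => O (newCode (r n)) := hO.comp (show Computable fun n => newCode (r n) from Computable.encode.comp hc)
  refine ⟨fun n => (O (newCode (r n))).unpair.1 / 2, fun n => (O (newCode (r n))).unpair.2,
    ?_, ?_, ?_⟩
  · exact Primrec.nat_div.to_comp.comp
      (Computable.fst.comp (Computable.unpair.comp hx)) (Computable.const 2)
  · exact Computable.snd.comp (Computable.unpair.comp hx)
  · intro n
    simp only [← h, oldCode_eq, Nat.unpair_pair]
    refine ⟨(r n).den_pos, ?_⟩
    have h0 : 0 ≤ (r n).num := (Rat.num_pos.2 (hr n)).le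
    obtain ⟨k, hk⟩ := Int.eq_ofNat_of_zero_le h0
    have : encode (r n).num / 2 = k := by
      rw [hk, int_encode_nonneg]; omega
    rw [this]
    conv_lhs => rw [← Rat.num_div_den (r n), hk]
    simp

end Stmt17Aux

namespace Stmt17Aux
open Encodable

theorem exists_stage {T : Type} [Primcodable T] (S : Set T) (hS : IsRE S) :
    ∃ c : ℕ × T → Bool, Computable c ∧ ∀ a, a ∈ S ↔ ∃ k, c (k, a) = true := by
  obtain ⟨code, hcode⟩ := Nat.Partrec.Code.exists_code.1 hS
  refine ⟨fun p => (Nat.Partrec.Code.evaln p.1 code (encode p.2)).isSome, ?_, fun a => ?_⟩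
  · refine (Primrec.option_isSome.comp ?_).to_comp
    exact Nat.Partrec.Code.primrec_evaln.comp
      ((Primrec.fst.pair (Primrec.const code)).pair (Primrec.encode.comp Primrec.snd))
  · have h : a ∈ S ↔ ∃ x, x ∈ code.eval (encode a) := by
      rw [hcode]
      simp
    rw [h]
    constructor
    · rintro ⟨x, hx⟩
      obtain ⟨k, hk⟩ := Nat.Partrec.Code.evaln_complete.1 hx
      exact ⟨k, Option.isSome_iff_exists.2 ⟨x, hk⟩⟩
    · rintro ⟨k, hk⟩
      obtain ⟨x, hx⟩ := Option.isSome_iff_exists.1 hk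
      exact ⟨x, Nat.Partrec.Code.evaln_sound hx⟩

theorem isRE_of_eq {T U : Type} [Primcodable T] [Primcodable U] [DecidableEq U] (f g : T → U)
    (hf : Computable f) (hg : Computable g) : IsRE {x | f x = g x} := by
  have : ComputablePred fun x => f x = g x := by
    refine Computable.computablePred ?_
    exact Primrec.eq.decide.to_comp.comp hf hg
  exact this.to_re

theorem recOp (T : ℕ → ℕ) (G : ℕ × ℕ × ℕ → ℕ) (hT : Computable T) (hG : Computable G) :
    IsRecOp fun u n => (u (T n)).bind fun a => (u 0).bind fun b => Part.some (G (n, a, b)) := by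
  let pa : List (ℕ × ℕ) × ℕ × ℕ → ℕ := fun x => ((x.1[0]?).getD (0, 0)).2
  let pb : List (ℕ × ℕ) × ℕ × ℕ → ℕ := fun x => ((x.1[1]?).getD (0, 0)).2
  have hpa : Computable pa := Computable.snd.comp (Computable.option_getD
    (Computable.list_getElem?.comp Computable.fst (Computable.const 0)) (Computable.const (0, 0)))
  have hpb : Computable pb := Computable.snd.comp (Computable.option_getD
    (Computable.list_getElem?.comp Computable.fst (Computable.const 1)) (Computable.const (0, 0)))
  have hn : Computable fun x : List (ℕ × ℕ) × ℕ × ℕ => x.2.1 := Computable.fst.comp Computable.snd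
  have hm : Computable fun x : List (ℕ × ℕ) × ℕ × ℕ => x.2.2 := Computable.snd.comp Computable.snd
  refine ⟨{x | (x.1, x.2.2) = ([(T x.2.1, pa x), (0, pb x)], G (x.2.1, pa x, pb x))}, ?_, ?_⟩
  · refine isRE_of_eq _ _ (Computable.fst.pair hm) (Computable.pair ?_ ?_)
    · exact Computable.list_cons.comp ((hT.comp hn).pair hpa)
        (Computable.list_cons.comp ((Computable.const 0).pair hpb) (Computable.const []))
    · exact hG.comp (hn.pair (hpa.pair hpb))
  · intro u n m
    simp only [Part.mem_bind_iff, Part.mem_some_iff, Set.mem_setOf_eq, Prod.mk.injEq]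
    constructor
    · rintro ⟨a, ha, b, hb, rfl⟩
      exact ⟨[(T n, a), (0, b)], by simp [ha, hb], by simp [pa, pb]⟩
    · rintro ⟨l, hl, h1, h2⟩
      refine ⟨_, hl (T n, pa (l, n, m)) ?_, _, hl (0, pb (l, n, m)) ?_, h2⟩
      · rw [h1]; simp [pa]
      · rw [h1]; simp [pb]

end Stmt17Aux

namespace Stmt17Aux
open Encodable

theorem main_aux {Y : Type*} [MetricSpace Y]
    (L : Set ℕ) (β : ℕ → Y) (hY : SemiComputable L β)
    (r : ℕ → ℚ) (hrpos : ∀ n, 0 < r n)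
    (hracc : ∀ ε : ℝ, 0 < ε → ∃ n, (r n : ℝ) < ε) (hrcomp : Computable r) :
    ∃ Γ : (ℕ →. ℕ) → (ℕ →. ℕ), IsRecOp Γ ∧
      ∀ y : Y, ∀ v : ℕ → ℕ, (∀ t, v t ∈ L ∧ dist (β (v t)) y < (r t : ℝ)) →
        ∃ w : ℕ → ℕ,
          (∀ p : ℕ, Γ (fun t => Part.some (v t)) p = Part.some (w p)) ∧
          Set.range w =
            {j | ∃ l ∈ L, ∃ n : ℕ, j = Nat.pair l n ∧ dist (β l) y < (r n : ℝ)} := by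
  obtain ⟨A, B, hA, hB, hAB⟩ := num_den_computable r hrpos hrcomp
  obtain ⟨c, hc, hcS⟩ := exists_stage _ hY.2
  let D : ℕ → ℕ × ℕ × ℕ × ℕ × ℕ × ℕ := Denumerable.ofNat _
  have hD : Computable D := (Primrec.ofNat _).to_comp
  -- D p = (k, l, t, n, x, y)
  let test : ℕ × ℕ × ℕ → Bool := fun q =>
    c ((D q.1).1, (D q.1).2.1, q.2.1, (D q.1).2.2.2.2.1, (D q.1).2.2.2.2.2) &&
    decide ((D q.1).2.2.2.2.1 * (B (D q.1).2.2.1 * B (D q.1).2.2.2.1) +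
      A (D q.1).2.2.1 * ((D q.1).2.2.2.2.2 * B (D q.1).2.2.2.1) <
      A (D q.1).2.2.2.1 * ((D q.1).2.2.2.2.2 * B (D q.1).2.2.1))
  let G : ℕ × ℕ × ℕ → ℕ := fun q =>
    cond (test q) (Nat.pair (D q.1).2.1 (D q.1).2.2.2.1) (Nat.pair q.2.2 0)
  have d1 : Computable fun p => (D p).1 := Computable.fst.comp hD
  have e1 : Computable fun p => (D p).2 := Computable.snd.comp hD
  have d2 : Computable fun p => (D p).2.1 := Computable.fst.comp e1
  have e2 : Computable fun p => (D p).2.2 := Computable.snd.comp e1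
  have d3 : Computable fun p => (D p).2.2.1 := Computable.fst.comp e2
  have e3 : Computable fun p => (D p).2.2.2 := Computable.snd.comp e2
  have d4 : Computable fun p => (D p).2.2.2.1 := Computable.fst.comp e3
  have e4 : Computable fun p => (D p).2.2.2.2 := Computable.snd.comp e3
  have d5 : Computable fun p => (D p).2.2.2.2.1 := Computable.fst.comp e4
  have d6 : Computable fun p => (D p).2.2.2.2.2 := Computable.snd.comp e4
  have hmul := Primrec.nat_mul.to_comp
  have hadd := Primrec.nat_add.to_comp
  have hlt : Computable fun p : ℕ => decide ((D p).2.2.2.2.1 * (B (D p).2.2.1 * B (D p).2.2.2.1) +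
      A (D p).2.2.1 * ((D p).2.2.2.2.2 * B (D p).2.2.2.1) <
      A (D p).2.2.2.1 * ((D p).2.2.2.2.2 * B (D p).2.2.1)) := by
    refine Primrec.nat_lt.decide.to_comp.comp (hadd.comp ?_ ?_) ?_
    · exact hmul.comp d5 (hmul.comp (hB.comp d3) (hB.comp d4))
    · exact hmul.comp (hA.comp d3) (hmul.comp d6 (hB.comp d4))
    · exact hmul.comp (hA.comp d4) (hmul.comp d6 (hB.comp d3))
  have f1 : Computable fun q : ℕ × ℕ × ℕ => q.1 := Computable.fst
  have f2 : Computable fun q : ℕ × ℕ × ℕ => q.2.1 := Computable.fst.comp Computable.snd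
  have f3 : Computable fun q : ℕ × ℕ × ℕ => q.2.2 := Computable.snd.comp Computable.snd
  have htest : Computable test := by
    refine Primrec.and.to_comp.comp (hc.comp ?_) (hlt.comp f1)
    exact (d1.comp f1).pair ((d2.comp f1).pair (f2.pair ((d5.comp f1).pair (d6.comp f1))))
  have hG : Computable G := by
    refine Computable.cond htest ?_ ?_
    · exact Primrec₂.natPair.to_comp.comp (d2.comp f1) (d4.comp f1)
    · exact Primrec₂.natPair.to_comp.comp f3 (Computable.const 0)
  -- arithmetic
  have key : ∀ x y t n : ℕ, 0 < y →
      (x * (B t * B n) + A t * (y * B n) < A n * (y * B t) ↔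
        (x : ℝ) / y + (r t : ℝ) < (r n : ℝ)) := by
    intro x y t n hy
    have hBt : (0 : ℝ) < B t := by exact_mod_cast (hAB t).1
    have hBn : (0 : ℝ) < B n := by exact_mod_cast (hAB n).1
    have hy' : (0 : ℝ) < y := by exact_mod_cast hy
    rw [(hAB t).2, (hAB n).2]
    push_cast
    rw [div_add_div _ _ hy'.ne' hBt.ne', div_lt_div_iff₀ (by positivity) hBn]
    rw [← Nat.cast_lt (α := ℝ)]
    push_cast
    constructor <;> intro h <;> nlinarith
  refine ⟨_, recOp (fun p => (D p).2.2.1) G d3 hG, fun y v hv => ?_⟩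
  refine ⟨fun p => G (p, v (D p).2.2.1, v 0), fun p => by simp, ?_⟩
  ext j
  simp only [Set.mem_range, Set.mem_setOf_eq]
  constructor
  · rintro ⟨p, rfl⟩
    cases h : test (p, v (D p).2.2.1, v 0) with
    | false =>
      refine ⟨v 0, (hv 0).1, 0, ?_, (hv 0).2⟩
      simp [G, h]
    | true =>
      have h' := h
      simp only [test, Bool.and_eq_true, decide_eq_true_eq] at h'
      obtain ⟨h1, h2⟩ := h'
      have h3 := (hcS _).2 ⟨_, h1⟩
      simp only [Set.mem_setOf_eq] at h3
      obtain ⟨hl, -, -, hy, hd⟩ := h3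
      rw [key _ _ _ _ hy] at h2
      refine ⟨_, hl, (D p).2.2.2.1, by simp [G, h], ?_⟩
      have := dist_triangle (β (D p).2.1) (β (v (D p).2.2.1)) y
      have := (hv (D p).2.2.1).2
      linarith
  · rintro ⟨l, hl, n, rfl, hd⟩
    obtain ⟨t, ht⟩ := hracc (((r n : ℝ) - dist (β l) y) / 2) (by linarith)
    have h1 : dist (β l) (β (v t)) < (r n : ℝ) - r t := by
      have := dist_triangle_right (β l) (β (v t)) y
      have := (hv t).2
      linarith
    obtain ⟨s, hs1, hs2⟩ := exists_rat_btwn h1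
    have hs0 : 0 < s := by
      have : (0 : ℝ) < s := lt_of_le_of_lt dist_nonneg hs1
      exact_mod_cast this
    obtain ⟨x, hx⟩ := Int.eq_ofNat_of_zero_le (Rat.num_pos.2 hs0).le
    have hx0 : 0 < x := by
      have := Rat.num_pos.2 hs0
      omega
    have hsx : (s : ℝ) = (x : ℝ) / (s.den : ℝ) := by
      conv_lhs => rw [← Rat.num_div_den s, hx]
      push_cast
      rfl
    obtain ⟨k, hk⟩ := (hcS (l, v t, x, s.den)).1
      ⟨hl, (hv t).1, hx0, s.den_pos, by rw [← hsx]; exact hs1⟩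
    have hlt2 := (key x s.den t n s.den_pos).2 (by rw [← hsx]; linarith)
    have hDe : D (encode (k, l, t, n, x, s.den)) = (k, l, t, n, x, s.den) :=
      Denumerable.ofNat_encode _
    refine ⟨encode (k, l, t, n, x, s.den), ?_⟩
    simp only [G, test, hDe, hk, hlt2, decide_true, Bool.and_self, cond_true]

end Stmt17Aux

/-- for semi-computable metric spaces (X,d,α) and (Y,e,β), there is a
recursive operator Γ transforming every β-name of every y ∈ Y into a V-name of y,
i.e. a total enumeration of [y]_V = {⟨l,n⟩ | l ∈ L, e(β l, y) < r n}. -/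
theorem stmt17 {X Y : Type*} [MetricSpace X] [MetricSpace Y]
    (K L : Set ℕ) (α : ℕ → X) (β : ℕ → Y)
    (hX : SemiComputable K α) (hY : SemiComputable L β)
    (r : ℕ → ℚ) (hrpos : ∀ n, 0 < r n)
    (hracc : ∀ ε : ℝ, 0 < ε → ∃ n, (r n : ℝ) < ε) (hrcomp : Computable r) :
    ∃ Γ : (ℕ →. ℕ) → (ℕ →. ℕ), IsRecOp Γ ∧
      ∀ y : Y, ∀ v : ℕ → ℕ, (∀ t, v t ∈ L ∧ dist (β (v t)) y < (r t : ℝ)) →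
        ∃ w : ℕ → ℕ,
          (∀ p : ℕ, Γ (fun t => Part.some (v t)) p = Part.some (w p)) ∧
          Set.range w =
            {j | ∃ l ∈ L, ∃ n : ℕ, j = Nat.pair l n ∧ dist (β l) y < (r n : ℝ)} := by
  exact Stmt17Aux.main_aux L β hY r hrpos hracc hrcomp
end
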